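/- arXiv:0808.0294 — 3 statements merged into one kernel-verified Lean document; each statement's English description precedes it below -/
import Mathlib

section
/- Let T = ℤ^17 with Gram matrix G_T the orthogonal block sum of U, U, E_8 and five copies of A_1. Then the natural homomorphism O(T) → O(q_T) is surjective: every additive automorphism of the discriminant group A_T = T*/T that preserves the discriminant quadratic form q_T is induced by an isometry P of T (P ∈ GL(17,ℤ) with PᵀG_T P = G_T). -/
open Matrix

/-- Gram matrix of the hyperbolic plane `U`. -/
def gramU : Matrix (Fin 2) (Fin 2) ℤ := !![0, 1; 1, 0]

/-- Gram matrix of the negative definite root lattice whose Dynkin diagram is a chain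
on nodes `0, …, n-2` together with an extra node `n-1` attached to node `k`;
for `E₈` the chain has 7 nodes and the extra node is attached to node `2`. -/
def gramRoot (n k : ℕ) : Matrix (Fin n) (Fin n) ℤ :=
  Matrix.of fun i j =>
    if i = j then -2
    else if (((i : ℕ) + 1 = j ∨ (j : ℕ) + 1 = i) ∧ (i : ℕ) + 1 ≠ n ∧ (j : ℕ) + 1 ≠ n) ∨
        ((i : ℕ) + 1 = n ∧ (j : ℕ) = k) ∨ ((j : ℕ) + 1 = n ∧ (i : ℕ) = k) then 1
    else 0

/-- Gram matrix of the standard negative definite root lattice `E₈`. -/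
def gramE8 : Matrix (Fin 8) (Fin 8) ℤ := gramRoot 8 2

/-- Orthogonal (block diagonal) sum of two Gram matrices. -/
def blockSum {m n : ℕ} (A : Matrix (Fin m) (Fin m) ℤ) (B : Matrix (Fin n) (Fin n) ℤ) :
    Matrix (Fin (m + n)) (Fin (m + n)) ℤ :=
  Matrix.of fun i j =>
    if hi : (i : ℕ) < m then
      if hj : (j : ℕ) < m then A ⟨i, hi⟩ ⟨j, hj⟩ else 0
    else
      if hj : (j : ℕ) < m then 0
      else B ⟨(i : ℕ) - m, by have := i.isLt; omega⟩ ⟨(j : ℕ) - m, by have := j.isLt; omega⟩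

/-- Gram matrix of `T = U ⊕ U ⊕ E₈ ⊕ A₁⁵` (coordinates: `e, f` at indices 0,1;
the second copy of `U` at indices 2,3; `E₈` at indices 4–11; `r₁, …, r₅` at indices 12–16). -/
def gramT : Matrix (Fin 17) (Fin 17) ℤ :=
  blockSum gramU (blockSum gramU (blockSum gramE8 (Matrix.diagonal fun _ : Fin 5 => (-2 : ℤ))))

/-- `P` is an isometry of the lattice `(ℤⁿ, G)`, i.e. `P ∈ GL(n, ℤ)` with `Pᵀ G P = G`. -/
def IsIsometry {n : ℕ} (G P : Matrix (Fin n) (Fin n) ℤ) : Prop :=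
  IsUnit P.det ∧ Pᵀ * G * P = G

/-- The `ℚ`-bilinear form of a lattice with Gram matrix `G`. -/
def bfQ {n : ℕ} (G : Matrix (Fin n) (Fin n) ℤ) (x y : Fin n → ℚ) : ℚ :=
  x ⬝ᵥ (G.map ((↑) : ℤ → ℚ)).mulVec y

/-- `ℤⁿ ⊆ ℚⁿ` as an additive subgroup. -/
def intLattice (n : ℕ) : AddSubgroup (Fin n → ℚ) :=
  AddSubgroup.pi Set.univ fun _ => AddSubgroup.zmultiples (1 : ℚ)

/-- The dual lattice `L* = {x ∈ ℚⁿ : B(x, ℤⁿ) ⊆ ℤ} = {x : Gx ∈ ℤⁿ}`. -/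
def dualLattice {n : ℕ} (G : Matrix (Fin n) (Fin n) ℤ) : AddSubgroup (Fin n → ℚ) :=
  AddSubgroup.comap ((G.map ((↑) : ℤ → ℚ)).mulVecLin.toAddMonoidHom) (intLattice n)

/-- The discriminant group `A_L = L*/L`. -/
def discGroup {n : ℕ} (G : Matrix (Fin n) (Fin n) ℤ) : Type :=
  (dualLattice G) ⧸ ((intLattice n).addSubgroupOf (dualLattice G))

instance {n : ℕ} (G : Matrix (Fin n) (Fin n) ℤ) : AddCommGroup (discGroup G) :=
  QuotientAddGroup.Quotient.addCommGroup _

/-- The class of a dual vector in the discriminant group. -/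
def discCls {n : ℕ} (G : Matrix (Fin n) (Fin n) ℤ) (x : dualLattice G) : discGroup G :=
  QuotientAddGroup.mk x

/-- Inverse of the Gram matrix of `E₈`. -/
def invE8 : Matrix (Fin 8) (Fin 8) ℤ :=
  !![-4, -7, -10, -8, -6, -4, -2, -5; -7, -14, -20, -16, -12, -8, -4, -10;
    -10, -20, -30, -24, -18, -12, -6, -15; -8, -16, -24, -20, -15, -10, -5, -12;
    -6, -12, -18, -15, -12, -8, -4, -9; -4, -8, -12, -10, -8, -6, -3, -6;
    -2, -4, -6, -5, -4, -3, -2, -3; -5, -10, -15, -12, -9, -6, -3, -8]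

/-- Almost-inverse of `gramT`. -/
def invT : Matrix (Fin 17) (Fin 17) ℤ :=
  blockSum gramU (blockSum gramU (blockSum invE8 (Matrix.diagonal fun _ : Fin 5 => (-1 : ℤ))))

/-- exponents: `1` on the unimodular part and `2` on the `A₁` part. -/
def dT (i : Fin 17) : ℤ := if (i : ℕ) < 12 then 1 else 2

set_option maxRecDepth 100000 in
theorem invT_mul : invT * gramT = Matrix.diagonal dT := by
  decide +kernel

theorem gramT_01 : ∀ (i : Fin 12) (j : Fin 5),
    gramT (Fin.castAdd 5 i) (Fin.natAdd 12 j) = 0 := by decide +kernel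

theorem gramT_10 : ∀ (i : Fin 12) (j : Fin 5),
    gramT (Fin.natAdd 12 j) (Fin.castAdd 5 i) = 0 := by decide +kernel

theorem gramT_11 : ∀ (i j : Fin 5),
    gramT (Fin.natAdd 12 i) (Fin.natAdd 12 j) = if i = j then -2 else 0 := by decide +kernel

theorem mem_intLattice {n : ℕ} (x : Fin n → ℚ) :
    x ∈ intLattice n ↔ ∀ i, ∃ k : ℤ, (k : ℚ) = x i := by
  simp [intLattice, AddSubgroup.mem_pi, AddSubgroup.mem_zmultiples_iff]

theorem mem_dual {n : ℕ} (G : Matrix (Fin n) (Fin n) ℤ) (x : Fin n → ℚ) :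
    x ∈ dualLattice G ↔ ∀ i, ∃ k : ℤ, (k : ℚ) = (G.map ((↑) : ℤ → ℚ)).mulVec x i := by
  rw [← mem_intLattice]; rfl

theorem dual_coord (x : Fin 17 → ℚ) (hx : x ∈ dualLattice gramT) (i : Fin 17) :
    ∃ k : ℤ, (k : ℚ) = dT i * x i := by
  rw [mem_dual] at hx
  choose k hk using hx
  have h1 : ((invT * gramT).map ((↑) : ℤ → ℚ)).mulVec x =
      (invT.map ((↑) : ℤ → ℚ)).mulVec ((gramT.map ((↑) : ℤ → ℚ)).mulVec x) := by
    rw [Matrix.mulVec_mulVec]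
    congr 1
    exact Matrix.map_mul_intCast invT gramT
  have h2 := congrFun h1 i
  rw [invT_mul, Matrix.diagonal_map (by simp), Matrix.mulVec_diagonal] at h2
  refine ⟨∑ j, invT i j * k j, ?_⟩
  refine Eq.trans ?_ h2.symm
  rw [Int.cast_sum, Matrix.mulVec, dotProduct]
  refine Finset.sum_congr rfl fun j _ => ?_
  rw [Int.cast_mul, hk, Matrix.map_apply]

/-- The vector `m / 2` in the `A₁⁵` part. -/
def wv (m : Fin 5 → ℤ) : Fin 17 → ℚ :=
  Fin.append (0 : Fin 12 → ℚ) (fun i => (m i : ℚ) / 2)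

theorem gram_wv (m : Fin 5 → ℤ) :
    (gramT.map ((↑) : ℤ → ℚ)).mulVec (wv m) =
      Fin.append (0 : Fin 12 → ℚ) (fun i => -(m i : ℚ)) := by
  funext i
  rw [Matrix.mulVec, dotProduct, Fin.sum_univ_add (a := 12) (b := 5)]
  induction i using Fin.addCases (m := 12) (n := 5) with
  | left i => simp [wv, gramT_01]
  | right i => simp [wv, gramT_11]; ring

theorem wv_mem (m : Fin 5 → ℤ) : wv m ∈ dualLattice gramT := by
  rw [mem_dual, gram_wv]
  intro i
  induction i using Fin.addCases (m := 12) (n := 5) with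
  | left i => exact ⟨0, by simp⟩
  | right i => exact ⟨-m i, by simp⟩

def wd (m : Fin 5 → ℤ) : dualLattice gramT := ⟨wv m, wv_mem m⟩

theorem bf_wv (m : Fin 5 → ℤ) : bfQ gramT (wv m) (wv m) = -(∑ i, m i ^ 2 : ℤ) / 2 := by
  rw [bfQ, gram_wv, dotProduct, Fin.sum_univ_add (a := 12) (b := 5)]
  simp [wv, Finset.sum_div, ← Finset.sum_neg_distrib]
  exact Finset.sum_congr rfl fun i _ => by ring

theorem cls_eq {x y : dualLattice gramT} :
    discCls gramT x = discCls gramT y ↔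
      ∀ i, ∃ k : ℤ, (k : ℚ) = (y : Fin 17 → ℚ) i - (x : Fin 17 → ℚ) i := by
  rw [discCls, discCls]
  refine QuotientAddGroup.eq.trans ?_
  rw [AddSubgroup.mem_addSubgroupOf, mem_intLattice]
  refine forall_congr' fun i => exists_congr fun k => ?_
  simp [sub_eq_neg_add]

/-- The classes of the vectors `m / 2`, as a homomorphism. -/
def wc : (Fin 5 → ℤ) →+ discGroup gramT where
  toFun m := discCls gramT (wd m)
  map_zero' := by
    change _ = discCls gramT 0
    congr 1
    apply Subtype.ext
    funext i
    induction i using Fin.addCases (m := 12) (n := 5) with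
    | left i => simp [wd, wv]
    | right i => simp [wd, wv]
  map_add' a b := by
    change _ = discCls gramT (wd a + wd b)
    congr 1
    apply Subtype.ext
    funext i
    induction i using Fin.addCases (m := 12) (n := 5) with
    | left i => simp [wd, wv]
    | right i => simp [wd, wv]; ring

theorem dual_rep (x : dualLattice gramT) : ∃ m : Fin 5 → ℤ,
    (∀ i, (m i : ℚ) = 2 * (x : Fin 17 → ℚ) (Fin.natAdd 12 i)) ∧ discCls gramT x = wc m := by
  have h := dual_coord x x.2
  have h2 : ∀ i : Fin 5, ∃ k : ℤ, (k : ℚ) = 2 * (x : Fin 17 → ℚ) (Fin.natAdd 12 i) := by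
    intro i
    simpa [dT] using h (Fin.natAdd 12 i)
  choose m hm using h2
  refine ⟨m, hm, ?_⟩
  refine cls_eq.2 fun i => ?_
  induction i using Fin.addCases (m := 12) (n := 5) with
  | left i =>
    obtain ⟨k, hk⟩ := h (Fin.castAdd 5 i)
    refine ⟨-k, ?_⟩
    have : dT (Fin.castAdd 5 i) = 1 := by simp [dT]
    rw [this] at hk
    simp [wd, wv, hk]
  | right i => exact ⟨0, by simp [wd, wv, hm]⟩

/-- 0/1 vector. -/
def bv (b : Fin 5 → Bool) : Fin 5 → ℤ := fun i => if b i then 1 else 0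

theorem cls_rep (a : discGroup gramT) : ∃ b : Fin 5 → Bool, a = wc (bv b) := by
  obtain ⟨x, rfl⟩ : ∃ x, discCls gramT x = a := QuotientAddGroup.mk_surjective a
  obtain ⟨m, -, hm⟩ := dual_rep x
  refine ⟨fun i => decide (m i % 2 = 1), hm.trans ?_⟩
  refine cls_eq.2 fun i => ?_
  induction i using Fin.addCases (m := 12) (n := 5) with
  | left i => exact ⟨0, by simp [wd, wv]⟩
  | right i =>
    refine ⟨-(m i / 2), ?_⟩
    have h0 := Int.emod_add_mul_ediv (m i) 2
    have h1 : (m i : ℚ) = ((m i % 2 : ℤ) : ℚ) + 2 * ((m i / 2 : ℤ) : ℚ) := by exact_mod_cast h0.symm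
    simp only [wd, wv, bv, Fin.append_right]
    rw [h1]
    rcases Int.emod_two_eq_zero_or_one (m i) with h | h <;> simp [h] <;> ring

theorem wt_one : ∀ b : Fin 5 → Bool, (∑ i, bv b i ^ 2) % 4 = 1 →
    b = (fun _ => true) ∨ ∃ k, b = fun i => decide (i = k) := by
  decide +kernel

theorem pair_wt : ∀ b c : Fin 5 → Bool, (∑ i, bv b i ^ 2) % 4 = 1 → (∑ i, bv c i ^ 2) % 4 = 1 →
    (∑ i, (bv b + bv c) i ^ 2) % 4 = 2 → (∃ k, bv b = Pi.single k 1) ∧ b ≠ c := by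
  decide +kernel

theorem main_perm (f : discGroup gramT ≃+ discGroup gramT)
    (hf : ∀ x y : dualLattice gramT, f (discCls gramT x) = discCls gramT y →
      bfQ gramT y y - bfQ gramT x x ∈ AddSubgroup.zmultiples (2 : ℚ)) :
    ∃ σ : Equiv.Perm (Fin 5), ∀ i, f (wc (Pi.single i 1)) = wc (Pi.single (σ i) 1) := by
  have key : ∀ m n : Fin 5 → ℤ, f (wc m) = wc n →
      (∑ i, n i ^ 2) % 4 = (∑ i, m i ^ 2) % 4 := by
    intro m n h
    have h1 := hf (wd m) (wd n) h
    obtain ⟨k, hk⟩ := AddSubgroup.mem_zmultiples_iff.1 h1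
    have hk' : (k : ℚ) * 2 = -(∑ i, n i ^ 2 : ℤ) / 2 - -(∑ i, m i ^ 2 : ℤ) / 2 := by
      rw [← bf_wv, ← bf_wv]; simpa [wd] using hk
    have h2 : (∑ i, m i ^ 2 : ℤ) - (∑ i, n i ^ 2 : ℤ) = 4 * k := by
      have : (((∑ i, m i ^ 2 : ℤ) - (∑ i, n i ^ 2 : ℤ) : ℤ) : ℚ) = ((4 * k : ℤ) : ℚ) := by
        rw [Int.cast_sub, Int.cast_mul]
        push_cast at hk' ⊢
        linarith
      exact_mod_cast this
    omega
  choose b hb using fun i : Fin 5 => cls_rep (f (wc (Pi.single i 1)))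
  have hs : ∀ i : Fin 5, (∑ j, (Pi.single i 1 : Fin 5 → ℤ) j ^ 2) % 4 = 1 := by decide
  have hp : ∀ i j : Fin 5, i ≠ j →
      (∑ l, (Pi.single i 1 + Pi.single j 1 : Fin 5 → ℤ) l ^ 2) % 4 = 2 := by decide +kernel
  have h1 : ∀ i, (∑ l, bv (b i) l ^ 2) % 4 = 1 := fun i => (key _ _ (hb i)).trans (hs i)
  have h2 : ∀ i j, i ≠ j → (∑ l, (bv (b i) + bv (b j)) l ^ 2) % 4 = 2 := fun i j hij =>
    (key _ _ (by rw [map_add, map_add, map_add, hb, hb])).trans (hp i j hij)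
  have h3 : ∀ i, ∃ k, bv (b i) = Pi.single k 1 := fun i => by
    obtain ⟨j, hj⟩ := exists_ne i
    exact (pair_wt _ _ (h1 i) (h1 j) (h2 i j hj.symm)).1
  choose s hs' using h3
  have hinj : Function.Injective s := by
    intro i j hij
    by_contra hne
    apply (pair_wt _ _ (h1 i) (h1 j) (h2 i j hne)).2
    have h4 : bv (b i) = bv (b j) := by rw [hs', hs', hij]
    funext l
    have := congrFun h4 l
    revert this
    simp only [bv]
    cases b i l <;> cases b j l <;> simp
  refine ⟨Equiv.ofBijective s (Finite.injective_iff_bijective.1 hinj), fun i => ?_⟩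
  rw [hb, hs']
  rfl

/-- Extension of a permutation of the `A₁` summands by the identity. -/
def ext17 (σ : Equiv.Perm (Fin 5)) : Equiv.Perm (Fin 17) :=
  (finSumFinEquiv (m := 12) (n := 5)).symm.trans
    ((Equiv.sumCongr (Equiv.refl _) σ).trans (finSumFinEquiv (m := 12) (n := 5)))

theorem ext17_left (σ : Equiv.Perm (Fin 5)) (i : Fin 12) :
    ext17 σ (Fin.castAdd 5 i) = Fin.castAdd 5 i := by
  have h := finSumFinEquiv_symm_apply_castAdd (m := 12) (n := 5) i
  change finSumFinEquiv (Sum.map id σ (finSumFinEquiv.symm (Fin.castAdd 5 i))) = _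
  exact (congrArg (fun z => finSumFinEquiv (Sum.map id σ z)) h).trans rfl

theorem ext17_right (σ : Equiv.Perm (Fin 5)) (i : Fin 5) :
    ext17 σ (Fin.natAdd 12 i) = Fin.natAdd 12 (σ i) := by
  have h := finSumFinEquiv_symm_apply_natAdd (m := 12) (n := 5) i
  change finSumFinEquiv (Sum.map id σ (finSumFinEquiv.symm (Fin.natAdd 12 i))) = _
  exact (congrArg (fun z => finSumFinEquiv (Sum.map id σ z)) h).trans rfl

theorem gram_ext (σ : Equiv.Perm (Fin 5)) (i j : Fin 17) :
    gramT (ext17 σ i) (ext17 σ j) = gramT i j := by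
  induction i using Fin.addCases (m := 12) (n := 5) with
  | left i =>
    induction j using Fin.addCases (m := 12) (n := 5) with
    | left j => rw [ext17_left, ext17_left]
    | right j => rw [ext17_left, ext17_right, gramT_01, gramT_01]
  | right i =>
    induction j using Fin.addCases (m := 12) (n := 5) with
    | left j => rw [ext17_left, ext17_right, gramT_10, gramT_10]
    | right j => simp [ext17_right, gramT_11]

/-- Permutation matrix with `(P x) i = x (τ i)`. -/
def pm (τ : Equiv.Perm (Fin 17)) : Matrix (Fin 17) (Fin 17) ℤ :=
  Matrix.of fun i j => if τ i = j then 1 else 0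

theorem pm_mulVec (τ : Equiv.Perm (Fin 17)) (x : Fin 17 → ℚ) (i : Fin 17) :
    ((pm τ).map ((↑) : ℤ → ℚ)).mulVec x i = x (τ i) := by
  simp [pm, Matrix.mulVec, dotProduct]

theorem pm_isom (σ : Equiv.Perm (Fin 5)) : IsIsometry gramT (pm (ext17 σ)) := by
  constructor
  · have : pm (ext17 σ) = (ext17 σ).permMatrix ℤ := by
      ext i j
      simp [pm, Equiv.Perm.permMatrix, PEquiv.toMatrix_apply, eq_comm]
    rw [this, Matrix.det_permutation]
    exact (Units.isUnit _).map (Int.castRingHom ℤ)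
  · ext i j
    obtain ⟨i, rfl⟩ := (ext17 σ).surjective i
    obtain ⟨j, rfl⟩ := (ext17 σ).surjective j
    rw [gram_ext]
    simp [Matrix.mul_apply, pm]

/-- The natural map `O(T) → O(q_T)` is surjective: every additive automorphism of
`A_T = T*/T` which preserves the discriminant quadratic form `q_T` is induced by an
isometry of `T = U ⊕ U ⊕ E₈ ⊕ A₁⁵`. (Preservation of `q_T` and the induced action are
expressed on representatives: the isometry `P` induces the map sending the class of
`x ∈ T*` to the class of `Px`.) -/
theorem OT_to_OqT_surjective
    (f : discGroup gramT ≃+ discGroup gramT)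
    (hf : ∀ x y : dualLattice gramT, f (discCls gramT x) = discCls gramT y →
      bfQ gramT y y - bfQ gramT x x ∈ AddSubgroup.zmultiples (2 : ℚ)) :
    ∃ P : Matrix (Fin 17) (Fin 17) ℤ, IsIsometry gramT P ∧
      ∀ x y : dualLattice gramT,
        (y : Fin 17 → ℚ) = (P.map ((↑) : ℤ → ℚ)).mulVec x →
        f (discCls gramT x) = discCls gramT y := by
  obtain ⟨σ, hσ⟩ := main_perm f hf
  refine ⟨pm (ext17 σ.symm), pm_isom _, fun x y hxy => ?_⟩
  obtain ⟨m, hm, hx⟩ := dual_rep x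
  obtain ⟨n, hn, hy⟩ := dual_rep y
  rw [hx, hy]
  have hnm : n = fun i => m (σ.symm i) := by
    funext i
    have h1 := hn i
    rw [hxy, pm_mulVec, ext17_right, ← hm] at h1
    exact_mod_cast h1
  have e1 : m = ∑ i, m i • (Pi.single i 1 : Fin 5 → ℤ) := by
    funext j; simp [Finset.sum_apply, Pi.single_apply]
  have e2 : n = ∑ i, m i • (Pi.single (σ i) 1 : Fin 5 → ℤ) := by
    rw [hnm]
    funext j
    obtain ⟨j, rfl⟩ := σ.surjective j
    simp [Finset.sum_apply, Pi.single_apply]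
  rw [e2, e1]
  simp only [map_sum, map_zsmul, hσ]
  simp [Pi.single_apply]
end

section
/- Let L_K3 = ℤ^22 with the Gram matrix of U⊕U⊕U⊕E_8⊕E_8 and S = ℤ^5 with Gram diag(2,-2,-2,-2,-2). The primitive isometric embedding of S into L_K3 is unique up to an isometry of L_K3: if φ, φ' : ℤ^5 → ℤ^22 are two isometric embeddings with primitive images, then there exists γ ∈ O(L_K3) with φ' = γ ∘ φ. -/
open Matrix

/-- Gram matrix of `U(2)`. -/
def gramU2 : Matrix (Fin 2) (Fin 2) ℤ := !![0, 2; 2, 0]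

/-- Gram matrix of `A₁`. -/
def gramA1 : Matrix (Fin 1) (Fin 1) ℤ := !![-2]

/-- Gram matrix of the standard negative definite root lattice `E₇`. -/
def gramE7 : Matrix (Fin 7) (Fin 7) ℤ := gramRoot 7 2

/-- Gram matrix of the standard negative definite root lattice `D₄`. -/
def gramD4 : Matrix (Fin 4) (Fin 4) ℤ := gramRoot 4 1

/-- Gram matrix of the standard negative definite root lattice `D₆`. -/
def gramD6 : Matrix (Fin 6) (Fin 6) ℤ := gramRoot 6 1

/-- Gram matrix of the standard negative definite root lattice `D₁₂`. -/
def gramD12 : Matrix (Fin 12) (Fin 12) ℤ := gramRoot 12 1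

/-- Gram matrix of `S = A₁(-1) ⊕ A₁⁴`. -/
def gramS : Matrix (Fin 5) (Fin 5) ℤ := Matrix.diagonal ![2, -2, -2, -2, -2]

/-- Gram matrix of the K3 lattice `L_{K3} = U ⊕ U ⊕ U ⊕ E₈ ⊕ E₈`. -/
def gramK3 : Matrix (Fin 22) (Fin 22) ℤ :=
  blockSum gramU (blockSum gramU (blockSum gramU (blockSum gramE8 gramE8)))

section EichlerCriterion

variable {ι : Type*}

/-- Eichler transvections are isometries. -/
lemma exists_transvection (B : (ι → ℤ) →ₗ[ℤ] (ι → ℤ) →ₗ[ℤ] ℤ) (hs : ∀ x y, B x y = B y x) (S : Set (ι → ℤ))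
    (e a : (ι → ℤ)) (c : ℤ) (hee : B e e = 0) (hea : B e a = 0) (haa : B a a = 2 * c)
    (he : ∀ s ∈ S, B s e = 0) (ha : ∀ s ∈ S, B s a = 0) :
    ∃ g : (ι → ℤ) ≃ₗ[ℤ] (ι → ℤ), (∀ x y, B (g x) (g y) = B x y) ∧ (∀ s ∈ S, g s = s) ∧
      ∀ x, g x = x - B a x • e + B e x • a - (c * B e x) • e := by
  have hae : B a e = 0 := by rw [hs]; exact hea
  let T : (ι → ℤ) → (ι → ℤ) →ₗ[ℤ] (ι → ℤ) := fun a =>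
    LinearMap.id - (B a).smulRight e + (B e).smulRight a - c • (B e).smulRight e
  have hT : ∀ a x, T a x = x - B a x • e + B e x • a - (c * B e x) • e := by
    intro a x
    simp [T, mul_smul]
  have h1 : ∀ x, T a (T (-a) x) = x := by
    intro x
    rw [hT a, hT (-a)]
    simp only [map_add, map_sub, map_smul, map_neg, LinearMap.neg_apply, smul_eq_mul, hee, hea,
      hae, haa]
    module
  have h2 : ∀ x, T (-a) (T a x) = x := by
    intro x
    rw [hT (-a), hT a]
    simp only [map_add, map_sub, map_smul, map_neg, LinearMap.neg_apply, smul_eq_mul, hee, hea,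
      hae, haa]
    module
  refine ⟨LinearEquiv.ofLinearMap (T a) (T (-a)) (LinearMap.ext h1) (LinearMap.ext h2), ?_, ?_, ?_⟩
  · intro x y
    simp only [LinearEquiv.coe_ofLinearMap, hT, map_add, map_sub, map_smul, LinearMap.add_apply,
      LinearMap.sub_apply, LinearMap.smul_apply, smul_eq_mul, hee, hea, hae, haa]
    rw [hs x e, hs x a]
    ring
  · intro s hS
    simp only [LinearEquiv.coe_ofLinearMap, hT]
    rw [hs a s, hs e s, he s hS, ha s hS]
    simp
  · intro x
    simp only [LinearEquiv.coe_ofLinearMap, hT]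

/-- `x` and `y` are related by an isometry of `B` that fixes `S` pointwise. -/
def Reach (B : (ι → ℤ) →ₗ[ℤ] (ι → ℤ) →ₗ[ℤ] ℤ) (S : Set (ι → ℤ)) (x y : (ι → ℤ)) : Prop :=
  ∃ g : (ι → ℤ) ≃ₗ[ℤ] (ι → ℤ), (∀ x y, B (g x) (g y) = B x y) ∧ (∀ s ∈ S, g s = s) ∧ g x = y

lemma Reach.refl (B : (ι → ℤ) →ₗ[ℤ] (ι → ℤ) →ₗ[ℤ] ℤ) (S : Set (ι → ℤ)) (x : (ι → ℤ)) : Reach B S x x :=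
  ⟨LinearEquiv.refl ℤ (ι → ℤ), fun _ _ => rfl, fun _ _ => rfl, rfl⟩

lemma Reach.symm {B : (ι → ℤ) →ₗ[ℤ] (ι → ℤ) →ₗ[ℤ] ℤ} {S : Set (ι → ℤ)} {x y : (ι → ℤ)} (h : Reach B S x y) :
    Reach B S y x := by
  obtain ⟨g, h1, h2, h3⟩ := h
  refine ⟨LinearEquiv.symm g, fun x y => ?_, fun s hs => ?_, ?_⟩
  · rw [← h1]; simp
  · rw [LinearEquiv.symm_apply_eq]; exact (h2 s hs).symm
  · rw [LinearEquiv.symm_apply_eq]; exact h3.symm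

lemma Reach.trans {B : (ι → ℤ) →ₗ[ℤ] (ι → ℤ) →ₗ[ℤ] ℤ} {S : Set (ι → ℤ)} {x y z : (ι → ℤ)} (h : Reach B S x y)
    (h' : Reach B S y z) : Reach B S x z := by
  obtain ⟨g, h1, h2, h3⟩ := h
  obtain ⟨k, k1, k2, k3⟩ := h'
  refine ⟨g.trans k, fun x y => ?_, fun s hs => ?_, ?_⟩
  · simp [h1, k1]
  · simp [h2 s hs, k2 s hs]
  · simp [h3, k3]

lemma Reach.norm {B : (ι → ℤ) →ₗ[ℤ] (ι → ℤ) →ₗ[ℤ] ℤ} {S : Set (ι → ℤ)} {x y : (ι → ℤ)} (h : Reach B S x y) :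
    B y y = B x x := by
  obtain ⟨g, h1, h2, h3⟩ := h
  rw [← h3, h1]

lemma Reach.step {B : (ι → ℤ) →ₗ[ℤ] (ι → ℤ) →ₗ[ℤ] ℤ} (hs : ∀ x y, B x y = B y x) {S : Set (ι → ℤ)} {v x : (ι → ℤ)}
    (h : Reach B S v x)
    (e a : (ι → ℤ)) (c : ℤ) (hee : B e e = 0) (hea : B e a = 0) (haa : B a a = 2 * c)
    (he : ∀ s ∈ S, B s e = 0) (ha : ∀ s ∈ S, B s a = 0) :
    Reach B S v (x - B a x • e + B e x • a - (c * B e x) • e) := by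
  obtain ⟨g, h1, h2, h3⟩ := exists_transvection B hs S e a c hee hea haa he ha
  exact h.trans ⟨g, h1, h2, h3 x⟩

/-- Two orthogonal hyperbolic planes `⟨e, f⟩`, `⟨p, q⟩`, both orthogonal to `S`. -/
structure TwoPlanes (B : (ι → ℤ) →ₗ[ℤ] (ι → ℤ) →ₗ[ℤ] ℤ) (S : Set (ι → ℤ)) (e f p q : (ι → ℤ)) : Prop where
  ee : B e e = 0
  ef : B e f = 1
  ep : B e p = 0
  eq : B e q = 0
  ff : B f f = 0
  fp : B f p = 0
  fq : B f q = 0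
  pp : B p p = 0
  pq : B p q = 1
  qq : B q q = 0
  se : ∀ s ∈ S, B s e = 0
  sf : ∀ s ∈ S, B s f = 0
  sp : ∀ s ∈ S, B s p = 0
  sq : ∀ s ∈ S, B s q = 0

lemma TwoPlanes.swap {B : (ι → ℤ) →ₗ[ℤ] (ι → ℤ) →ₗ[ℤ] ℤ} (hs : ∀ x y, B x y = B y x) {S : Set (ι → ℤ)}
    {e f p q : (ι → ℤ)} (H : TwoPlanes B S e f p q) : TwoPlanes B S e f q p :=
  ⟨H.ee, H.ef, H.eq, H.ep, H.ff, H.fq, H.fp, H.qq, (hs q p).trans H.pq, H.pp,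
    H.se, H.sf, H.sq, H.sp⟩

/-- The pairing with `p` can be shifted by multiples of the pairing with `f`. -/
lemma shift_p (B : (ι → ℤ) →ₗ[ℤ] (ι → ℤ) →ₗ[ℤ] ℤ) (hs : ∀ x y, B x y = B y x)
    {S : Set (ι → ℤ)} {e f p q : (ι → ℤ)} (H : TwoPlanes B S e f p q)
    {v x : (ι → ℤ)} (hx : Reach B S v x) (m : ℤ) :
    ∃ x', Reach B S v x' ∧ B f x' = B f x ∧ B p x' = B p x + m * B f x ∧ B q x' = B q x := by
  have hpf := (hs p f).trans H.fp
  have hqf := (hs q f).trans H.fq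
  refine ⟨_, hx.step hs f (m • q) 0 H.ff (by simp [-zsmul_eq_mul, H.fq]) (by simp [-zsmul_eq_mul, H.qq]) H.sf
    (by intro s hS; simp [-zsmul_eq_mul, H.sq s hS]), ?_, ?_, ?_⟩
  · simp [-zsmul_eq_mul, H.ff, H.fq]
  · simp [-zsmul_eq_mul, hpf, H.pq]; ring
  · simp [-zsmul_eq_mul, hqf, H.qq]

/-- The pairing with `f` can be shifted by multiples of the pairing with `p`. -/
lemma shift_f (B : (ι → ℤ) →ₗ[ℤ] (ι → ℤ) →ₗ[ℤ] ℤ) (hs : ∀ x y, B x y = B y x)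
    {S : Set (ι → ℤ)} {e f p q : (ι → ℤ)} (H : TwoPlanes B S e f p q)
    {v x : (ι → ℤ)} (hx : Reach B S v x) (m : ℤ) :
    ∃ x', Reach B S v x' ∧ B f x' = B f x - m * B p x := by
  have hfe := (hs f e).trans H.ef
  refine ⟨_, hx.step hs e (m • p) 0 H.ee (by simp [-zsmul_eq_mul, H.ep]) (by simp [-zsmul_eq_mul, H.pp]) H.se
    (by intro s hS; simp [-zsmul_eq_mul, H.sp s hS]), ?_⟩
  simp [-zsmul_eq_mul, H.fp, hfe]

/-- If `a` divides the pairing of every reachable vector `x` having `B f x = a` with `p` and `q`,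
and such an `x` exists, then `a` is a unit. -/
lemma dvd_one_of_minimal (B : (ι → ℤ) →ₗ[ℤ] (ι → ℤ) →ₗ[ℤ] ℤ) (hs : ∀ x y, B x y = B y x)
    (hev : ∀ x, ∃ c, B x x = 2 * c) {S : Set (ι → ℤ)} {e f p q : (ι → ℤ)} (H : TwoPlanes B S e f p q)
    {v y : (ι → ℤ)} (hy : ∀ s ∈ S, B s y = 0) (hvy : B v y = 1) (a : ℤ)
    (hp : ∀ x, Reach B S v x → B f x = a → a ∣ B p x)
    (hq : ∀ x, Reach B S v x → B f x = a → a ∣ B q x)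
    (x0 : (ι → ℤ)) (hx0 : Reach B S v x0) (hxa0 : B f x0 = a) : a ∣ 1 := by
  have hqp := (hs q p).trans H.pq
  -- make the pairings with `p` and `q` zero
  obtain ⟨x, hx, hxa, hpx, hqx⟩ : ∃ x, Reach B S v x ∧ B f x = a ∧ B p x = 0 ∧ B q x = 0 := by
    obtain ⟨b, hb⟩ := hp x0 hx0 hxa0
    obtain ⟨x1, hx1, hf1, hp1, hq1⟩ := shift_p B hs H hx0 (-b)
    obtain ⟨d, hd⟩ := hq x1 hx1 (hf1.trans hxa0)
    obtain ⟨x2, hx2, hf2, hq2, hp2⟩ := shift_p B hs (H.swap hs) hx1 (-d)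
    refine ⟨x2, hx2, by rw [hf2, hf1, hxa0], ?_, ?_⟩
    · rw [hp2, hp1, hb, hxa0]; ring
    · rw [hq2, hd, hf1, hxa0]; ring
  obtain ⟨g, h1, h2, h3⟩ := id hx
  have hz : ∀ s ∈ S, B s (g y) = 0 := by
    intro s hS
    rw [← h2 s hS, h1]
    exact hy s hS
  have hxz : B (g y) x = 1 := by
    rw [← h3, h1, hs]; exact hvy
  generalize g y = z at hz hxz
  obtain ⟨w, hw⟩ : ∃ w, w = z - B z p • q := ⟨_, rfl⟩
  have hpw : B p w = 0 := by
    rw [hw]; simp [-zsmul_eq_mul, H.pq, hs p z]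
  have hwx : B w x = 1 := by
    rw [hw]; simp [-zsmul_eq_mul, hxz, hqx]
  have hSw : ∀ s ∈ S, B s w = 0 := by
    intro s hS
    rw [hw]; simp [-zsmul_eq_mul, hz s hS, H.sq s hS]
  obtain ⟨c, hc⟩ := hev w
  have hr := hx.step hs p w c H.pp hpw hc H.sp hSw
  rw [hpx, hwx] at hr
  have h := hq _ hr (by simp [-zsmul_eq_mul, H.fp, hxa])
  simpa [-zsmul_eq_mul, hqx, hqp] using h

/-- Minimality forces divisibility. -/
lemma dvd_of_least (B : (ι → ℤ) →ₗ[ℤ] (ι → ℤ) →ₗ[ℤ] ℤ) (hs : ∀ x y, B x y = B y x)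
    {S : Set (ι → ℤ)} {e f p q : (ι → ℤ)} (H : TwoPlanes B S e f p q) {v : (ι → ℤ)} (a : ℤ) (ha : 0 < a)
    (hmin : ∀ x, Reach B S v x → 0 < B f x → a ≤ B f x)
    (x : (ι → ℤ)) (hx : Reach B S v x) (hxa : B f x = a) : a ∣ B p x := by
  by_contra hnd
  have hr0 : B p x % a ≠ 0 := fun h => hnd (Int.dvd_of_emod_eq_zero h)
  have hr1 := Int.emod_nonneg (B p x) ha.ne'
  have hr2 := Int.emod_lt_of_pos (B p x) ha
  obtain ⟨x1, hx1, hf1, hp1, -⟩ := shift_p B hs H hx (-(B p x / a))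
  obtain ⟨x2, hx2, hf2⟩ := shift_f B hs H hx1 1
  have hp1' : B p x1 = B p x % a := by
    rw [hp1, hxa, Int.emod_def]; ring
  rw [hf1, hxa, hp1'] at hf2
  have := hmin x2 hx2 (by omega)
  omega

/-- The Eichler criterion: a vector of divisor one can be moved to a standard form. -/
lemma eichler (B : (ι → ℤ) →ₗ[ℤ] (ι → ℤ) →ₗ[ℤ] ℤ) (hs : ∀ x y, B x y = B y x)
    (hev : ∀ x, ∃ c, B x x = 2 * c) {S : Set (ι → ℤ)} {e f p q : (ι → ℤ)} (H : TwoPlanes B S e f p q)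
    {v y : (ι → ℤ)} (hv : ∀ s ∈ S, B s v = 0) (hy : ∀ s ∈ S, B s y = 0) (hvy : B v y = 1) :
    ∃ m : ℤ, Reach B S v (e + m • f) := by
  have hfe := (hs f e).trans H.ef
  -- some reachable vector pairs with `f` to `1`
  obtain ⟨x, hx, hfx⟩ : ∃ x, Reach B S v x ∧ B f x = 1 := by
    classical
    by_cases hpos : ∃ n : ℕ, 0 < n ∧ ∃ x, Reach B S v x ∧ B f x = n
    · obtain ⟨hn, x, hx, hfx⟩ := Nat.find_spec hpos
      have hmin : ∀ x, Reach B S v x → 0 < B f x → ((Nat.find hpos : ℕ) : ℤ) ≤ B f x := by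
        intro x hx h0
        have := Nat.find_min' hpos (m := (B f x).toNat) ⟨by omega, x, hx, by omega⟩
        omega
      have hn' : (0 : ℤ) < ((Nat.find hpos : ℕ) : ℤ) := by exact_mod_cast hn
      have hd := dvd_one_of_minimal B hs hev H hy hvy _ (dvd_of_least B hs H _ hn' hmin)
        (dvd_of_least B hs (H.swap hs) _ hn' hmin) x hx hfx
      refine ⟨x, hx, ?_⟩
      rw [hfx]
      exact Int.eq_one_of_dvd_one hn'.le hd
    · exfalso
      have hneg : ∀ x, Reach B S v x → B f x ≤ 0 := by
        intro x hx
        by_contra h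
        exact hpos ⟨(B f x).toNat, by omega, x, hx, by omega⟩
      have key : ∀ p q, TwoPlanes B S e f p q → ∀ x, Reach B S v x → B p x = 0 := by
        intro p q H x hx
        by_contra h0
        obtain ⟨x', hx', hf'⟩ := shift_f B hs H hx ((B f x - 1) * B p x)
        have h1 := hneg x' hx'
        have h2 := hneg x hx
        have h3 : 1 ≤ B p x * B p x := by
          have : 0 < B p x * B p x := mul_self_pos.mpr h0
          omega
        nlinarith
      have hd := dvd_one_of_minimal B hs hev H hy hvy (B f v)
        (fun x hx _ => by rw [key p q H x hx]; exact dvd_zero _)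
        (fun x hx _ => by rw [key q p (H.swap hs) x hx]; exact dvd_zero _) v (Reach.refl B S v) rfl
      obtain ⟨x', hx', -, hp', -⟩ := shift_p B hs H (Reach.refl B S v) 1
      rw [key p q H x' hx', key p q H v (Reach.refl B S v)] at hp'
      have h0 : B f v = 0 := by linarith
      rw [h0] at hd
      norm_num at hd
  obtain ⟨g, h1, h2, h3⟩ := id hx
  have hSx : ∀ s ∈ S, B s x = 0 := by
    intro s hS
    rw [← h2 s hS, ← h3, h1]
    exact hv s hS
  obtain ⟨w, hw⟩ : ∃ w, w = e + B e x • f - x := ⟨_, rfl⟩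
  obtain ⟨c, hc⟩ := hev w
  have hr := hx.step hs f w c H.ff (by rw [hw]; simp [-zsmul_eq_mul, hfe, H.ff, hfx]) hc H.sf
    (by intro s hS; rw [hw]; simp [-zsmul_eq_mul, H.se s hS, H.sf s hS, hSx s hS])
  rw [hfx] at hr
  refine ⟨B e x - B w x - c, ?_⟩
  convert hr using 1
  generalize B w x = t
  rw [hw]
  module

/-- Two vectors of divisor one with the same norm are related. -/
lemma eichler_unique (B : (ι → ℤ) →ₗ[ℤ] (ι → ℤ) →ₗ[ℤ] ℤ) (hs : ∀ x y, B x y = B y x)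
    (hev : ∀ x, ∃ c, B x x = 2 * c) {S : Set (ι → ℤ)} {e f p q : (ι → ℤ)} (H : TwoPlanes B S e f p q)
    {v y v' y' : (ι → ℤ)} (hv : ∀ s ∈ S, B s v = 0) (hy : ∀ s ∈ S, B s y = 0) (hvy : B v y = 1)
    (hv' : ∀ s ∈ S, B s v' = 0) (hy' : ∀ s ∈ S, B s y' = 0) (hvy' : B v' y' = 1)
    (hn : B v v = B v' v') : Reach B S v v' := by
  obtain ⟨m, hm⟩ := eichler B hs hev H hv hy hvy
  obtain ⟨m', hm'⟩ := eichler B hs hev H hv' hy' hvy'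
  have hfe := (hs f e).trans H.ef
  have h1 := hm.norm
  have h2 := hm'.norm
  simp [-zsmul_eq_mul, H.ee, H.ef, H.ff, hfe] at h1 h2
  have : m = m' := by linarith
  subst this
  exact hm.trans hm'.symm

/-- Tuples of vectors admitting dual vectors are determined by their (diagonal) Gram matrix up to
isometry, if the target tuple is orthogonal to two hyperbolic planes. -/
lemma tuple_unique (B : (ι → ℤ) →ₗ[ℤ] (ι → ℤ) →ₗ[ℤ] ℤ) (hs : ∀ x y, B x y = B y x)
    (hev : ∀ x, ∃ c, B x x = 2 * c) {r : ℕ} (v y s z : Fin r → (ι → ℤ)) {e f p q : (ι → ℤ)}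
    (H : TwoPlanes B (Set.range s) e f p q)
    (hg : ∀ i j, B (v i) (v j) = B (s i) (s j)) (ho : ∀ i j, i ≠ j → B (s i) (s j) = 0)
    (hy : ∀ i j, B (v i) (y j) = if i = j then 1 else 0)
    (hz : ∀ i j, B (s i) (z j) = if i = j then 1 else 0) :
    ∃ g : (ι → ℤ) ≃ₗ[ℤ] (ι → ℤ), (∀ x y, B (g x) (g y) = B x y) ∧ ∀ i, g (v i) = s i := by
  have main : ∀ k : ℕ, k ≤ r → ∃ g : (ι → ℤ) ≃ₗ[ℤ] (ι → ℤ), (∀ x y, B (g x) (g y) = B x y) ∧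
      ∀ i : Fin r, (i : ℕ) < k → g (v i) = s i := by
    intro k
    induction k with
    | zero => exact fun _ => ⟨LinearEquiv.refl ℤ (ι → ℤ), fun _ _ => rfl, fun i hi => by omega⟩
    | succ k ih =>
      intro hk
      obtain ⟨g, h1, h2⟩ := ih (by omega)
      let j : Fin r := ⟨k, by omega⟩
      let S : Set (ι → ℤ) := {x | ∃ i : Fin r, (i : ℕ) < k ∧ x = s i}
      have hsub : ∀ x ∈ S, x ∈ Set.range s := by
        rintro x ⟨i, -, rfl⟩
        exact ⟨i, rfl⟩
      have H' : TwoPlanes B S e f p q :=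
        ⟨H.ee, H.ef, H.ep, H.eq, H.ff, H.fp, H.fq, H.pp, H.pq, H.qq,
          fun x hx => H.se x (hsub x hx), fun x hx => H.sf x (hsub x hx),
          fun x hx => H.sp x (hsub x hx), fun x hx => H.sq x (hsub x hx)⟩
      have hne : ∀ i : Fin r, (i : ℕ) < k → i ≠ j := by
        rintro i hi rfl
        exact absurd hi (lt_irrefl k)
      obtain ⟨g', k1, k2, k3⟩ : Reach B S (g (v j)) (s j) := by
        apply eichler_unique B hs hev H' (y := g (y j)) (y' := z j)
        · rintro x ⟨i, hi, rfl⟩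
          rw [← h2 i hi, h1, hg, ho i j (hne i hi)]
        · rintro x ⟨i, hi, rfl⟩
          rw [← h2 i hi, h1, hy, if_neg (hne i hi)]
        · rw [h1, hy, if_pos rfl]
        · rintro x ⟨i, hi, rfl⟩
          exact ho i j (hne i hi)
        · rintro x ⟨i, hi, rfl⟩
          rw [hz, if_neg (hne i hi)]
        · rw [hz, if_pos rfl]
        · rw [h1, hg]
      refine ⟨g.trans g', fun x y => ?_, fun i hi => ?_⟩
      · simp [h1, k1]
      · rw [LinearEquiv.trans_apply]
        rcases Nat.lt_succ_iff_lt_or_eq.mp hi with hi | hi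
        · rw [h2 i hi]
          exact k2 _ ⟨i, hi, rfl⟩
        · have : i = j := Fin.ext hi
          rw [this]
          exact k3
  obtain ⟨g, h1, h2⟩ := main r le_rfl
  exact ⟨g, h1, fun i => h2 i i.isLt⟩

end EichlerCriterion

/-- The inverse of the K3 Gram matrix. -/
def invK3 : Matrix (Fin 22) (Fin 22) ℤ :=
  blockSum gramU (blockSum gramU (blockSum gramU (blockSum invE8 invE8)))

lemma blockSum_eq {m n : ℕ} (A : Matrix (Fin m) (Fin m) ℤ) (B : Matrix (Fin n) (Fin n) ℤ) :
    blockSum A B =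
      (Matrix.fromBlocks A 0 0 B).submatrix finSumFinEquiv.symm finSumFinEquiv.symm := by
  ext i j
  obtain ⟨i, rfl⟩ := finSumFinEquiv.surjective i
  obtain ⟨j, rfl⟩ := finSumFinEquiv.surjective j
  rcases i with i | i <;> rcases j with j | j <;> simp [blockSum]

lemma blockSum_mul {m n : ℕ} (A C : Matrix (Fin m) (Fin m) ℤ) (B D : Matrix (Fin n) (Fin n) ℤ) :
    blockSum A B * blockSum C D = blockSum (A * C) (B * D) := by
  rw [blockSum_eq, blockSum_eq, blockSum_eq, Matrix.submatrix_mul_equiv, Matrix.fromBlocks_multiply]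
  simp

lemma blockSum_one {m n : ℕ} :
    blockSum (1 : Matrix (Fin m) (Fin m) ℤ) (1 : Matrix (Fin n) (Fin n) ℤ) = 1 := by
  rw [blockSum_eq, Matrix.fromBlocks_one, Matrix.submatrix_one_equiv]

lemma blockSum_transpose {m n : ℕ} (A : Matrix (Fin m) (Fin m) ℤ) (B : Matrix (Fin n) (Fin n) ℤ) :
    (blockSum A B)ᵀ = blockSum Aᵀ Bᵀ := by
  rw [blockSum_eq, blockSum_eq, Matrix.transpose_submatrix, Matrix.fromBlocks_transpose]
  simp

lemma blockSum_add {m n : ℕ} (A C : Matrix (Fin m) (Fin m) ℤ) (B D : Matrix (Fin n) (Fin n) ℤ) :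
    blockSum A B + blockSum C D = blockSum (A + C) (B + D) := by
  ext i j
  simp only [blockSum, Matrix.add_apply, Matrix.of_apply]
  split_ifs <;> simp

lemma blockSum_inv {m n : ℕ} {A C : Matrix (Fin m) (Fin m) ℤ} {B D : Matrix (Fin n) (Fin n) ℤ}
    (h : A * C = 1) (h' : B * D = 1) : blockSum A B * blockSum C D = 1 := by
  rw [blockSum_mul, h, h', blockSum_one]

lemma blockSum_symm {m n : ℕ} {A : Matrix (Fin m) (Fin m) ℤ} {B : Matrix (Fin n) (Fin n) ℤ}
    (h : Aᵀ = A) (h' : Bᵀ = B) : (blockSum A B)ᵀ = blockSum A B := by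
  rw [blockSum_transpose, h, h']

lemma blockSum_half {m n : ℕ} {A C : Matrix (Fin m) (Fin m) ℤ} {B D : Matrix (Fin n) (Fin n) ℤ}
    (h : C + Cᵀ = A) (h' : D + Dᵀ = B) :
    blockSum C D + (blockSum C D)ᵀ = blockSum A B := by
  rw [blockSum_transpose, blockSum_add, h, h']

lemma gramU_mul : gramU * gramU = 1 := by
  decide +kernel

lemma gramE8_mul : gramE8 * invE8 = 1 := by
  decide +kernel

lemma gramK3_mul_inv : gramK3 * invK3 = 1 :=
  blockSum_inv gramU_mul (blockSum_inv gramU_mul (blockSum_inv gramU_mul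
    (blockSum_inv gramE8_mul gramE8_mul)))

lemma gramU_symm : gramUᵀ = gramU := by
  decide +kernel

lemma gramE8_symm : gramE8ᵀ = gramE8 := by
  decide +kernel

lemma gramK3_symm : gramK3ᵀ = gramK3 :=
  blockSum_symm gramU_symm (blockSum_symm gramU_symm (blockSum_symm gramU_symm
    (blockSum_symm gramE8_symm gramE8_symm)))

/-- Half of the `U` form. -/
def halfU : Matrix (Fin 2) (Fin 2) ℤ := !![0, 1; 0, 0]

/-- Half of the `E₈` form. -/
def halfE8 : Matrix (Fin 8) (Fin 8) ℤ :=
  Matrix.of fun i j => if i < j then gramE8 i j else if i = j then -1 else 0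

lemma gramU_half : halfU + halfUᵀ = gramU := by
  decide +kernel

lemma gramE8_half : halfE8 + halfE8ᵀ = gramE8 := by
  decide +kernel

/-- Half of the K3 form. -/
def halfK3 : Matrix (Fin 22) (Fin 22) ℤ :=
  blockSum halfU (blockSum halfU (blockSum halfU (blockSum halfE8 halfE8)))

lemma gramK3_half : gramK3 = halfK3 + halfK3ᵀ :=
  (blockSum_half gramU_half (blockSum_half gramU_half (blockSum_half gramU_half
    (blockSum_half gramE8_half gramE8_half)))).symm

/-- The K3 bilinear form. -/
noncomputable def formK3 : (Fin 22 → ℤ) →ₗ[ℤ] (Fin 22 → ℤ) →ₗ[ℤ] ℤ := Matrix.toBilin' gramK3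

lemma formK3_apply (x y : Fin 22 → ℤ) : formK3 x y = x ⬝ᵥ gramK3.mulVec y := by
  unfold formK3
  rw [Matrix.toBilin'_apply']

lemma formK3_symm (x y : Fin 22 → ℤ) : formK3 x y = formK3 y x := by
  rw [formK3_apply, formK3_apply, Matrix.dotProduct_mulVec, ← Matrix.mulVec_transpose, gramK3_symm,
    dotProduct_comm]

lemma formK3_even (x : Fin 22 → ℤ) : ∃ c, formK3 x x = 2 * c := by
  refine ⟨x ⬝ᵥ halfK3.mulVec x, ?_⟩
  have h : x ⬝ᵥ halfK3ᵀ.mulVec x = x ⬝ᵥ halfK3.mulVec x := by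
    rw [Matrix.dotProduct_mulVec, ← Matrix.mulVec_transpose, Matrix.transpose_transpose,
      dotProduct_comm]
  rw [formK3_apply, gramK3_half, Matrix.add_mulVec, dotProduct_add, h]
  ring

lemma formK3_single (i j : Fin 22) : formK3 (Pi.single i 1) (Pi.single j 1) = gramK3 i j := by
  rw [formK3_apply]
  simp

/-- A primitive embedding admits dual vectors. -/
lemma exists_dual (φ : (Fin 5 → ℤ) →ₗ[ℤ] (Fin 22 → ℤ)) (hinj : Function.Injective φ)
    (hprim : ∀ (x : Fin 22 → ℤ) (c : ℤ), c ≠ 0 → c • x ∈ Set.range φ → x ∈ Set.range φ) :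
    ∃ y : Fin 5 → (Fin 22 → ℤ), ∀ i j, formK3 (φ (Pi.single i 1)) (y j) = if i = j then 1 else 0 := by
  have htf : Module.IsTorsionFree ℤ ((Fin 22 → ℤ) ⧸ LinearMap.range φ) := by
    refine Module.IsTorsionFree.of_smul_eq_zero ?_
    intro c x h
    by_cases hc : c = 0
    · exact Or.inl hc
    · right
      induction x using Submodule.Quotient.induction_on with
      | H x =>
        rw [← Submodule.Quotient.mk_smul, Submodule.Quotient.mk_eq_zero] at h
        rw [Submodule.Quotient.mk_eq_zero]
        exact hprim x c hc h
  have hfree : Module.Free ℤ ((Fin 22 → ℤ) ⧸ LinearMap.range φ) :=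
    Module.free_of_finite_type_torsion_free'
  obtain ⟨σ, hσ⟩ := Module.projective_lifting_property (LinearMap.range φ).mkQ LinearMap.id
    (Submodule.mkQ_surjective _)
  have hmem : ∀ x, (LinearMap.id - σ ∘ₗ (LinearMap.range φ).mkQ : (Fin 22 → ℤ) →ₗ[ℤ] _) x
      ∈ LinearMap.range φ := by
    intro x
    rw [← Submodule.Quotient.mk_eq_zero]
    have := LinearMap.congr_fun hσ (Submodule.Quotient.mk x)
    simp at this
    simp [this]
  let ψ : (Fin 22 → ℤ) →ₗ[ℤ] (Fin 5 → ℤ) :=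
    (LinearEquiv.ofInjective φ hinj).symm.toLinearMap ∘ₗ LinearMap.codRestrict _ _ hmem
  have hψ : ∀ t, ψ (φ t) = t := by
    intro t
    simp only [ψ, LinearMap.comp_apply, LinearEquiv.coe_coe]
    rw [LinearEquiv.symm_apply_eq]
    apply Subtype.ext
    have : (LinearMap.range φ).mkQ (φ t) = 0 := by simp
    simp [-Submodule.mkQ_apply, this]
  refine ⟨fun j => invK3.mulVec fun i => ψ (Pi.single i 1) j, fun i j => ?_⟩
  rw [formK3_apply, Matrix.mulVec_mulVec, gramK3_mul_inv, Matrix.one_mulVec]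
  have hlin : ∀ x : Fin 22 → ℤ, (x ⬝ᵥ fun i => ψ (Pi.single i 1) j) = ψ x j := by
    intro x
    conv_rhs => rw [pi_eq_sum_univ' x]
    simp [-zsmul_eq_mul, dotProduct, Finset.sum_apply]
  rw [hlin, hψ, Pi.single_apply]
  simp [eq_comm]

/-- The model vectors. -/
def modelS : Fin 5 → (Fin 22 → ℤ) :=
  ![Pi.single 0 1 + Pi.single 1 1, Pi.single 6 1, Pi.single 10 1, Pi.single 14 1, Pi.single 18 1]

/-- Dual vectors of the model vectors. -/
def modelZ : Fin 5 → (Fin 22 → ℤ) :=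
  ![Pi.single 0 1, Pi.single 7 1, Pi.single 11 1, Pi.single 15 1, Pi.single 19 1]

lemma model_gram (i j : Fin 5) : formK3 (modelS i) (modelS j) = gramS i j := by
  fin_cases i <;> fin_cases j <;>
    simp only [modelS, Fin.mk_zero, Fin.mk_one, Fin.reduceFinMk, Matrix.cons_val,
      map_add, LinearMap.add_apply, formK3_single] <;> decide +kernel

lemma model_dual (i j : Fin 5) : formK3 (modelS i) (modelZ j) = if i = j then 1 else 0 := by
  fin_cases i <;> fin_cases j <;>
    simp only [modelS, modelZ, Fin.mk_zero, Fin.mk_one, Fin.reduceFinMk,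
      Matrix.cons_val, map_add, LinearMap.add_apply, formK3_single] <;> decide +kernel

lemma model_orth (i : Fin 5) (j : Fin 22) (hj : j ∈ ({2, 3, 4, 5} : Finset (Fin 22))) :
    formK3 (modelS i) (Pi.single j 1) = 0 := by
  fin_cases hj <;> fin_cases i <;>
    simp only [modelS, Fin.mk_zero, Fin.mk_one, Fin.reduceFinMk,
      Matrix.cons_val, map_add, LinearMap.add_apply, formK3_single] <;> decide +kernel

lemma model_planes : TwoPlanes formK3 (Set.range modelS) (Pi.single 2 1) (Pi.single 3 1)
    (Pi.single 4 1) (Pi.single 5 1) := by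
  refine ⟨?_, ?_, ?_, ?_, ?_, ?_, ?_, ?_, ?_, ?_, ?_, ?_, ?_, ?_⟩
  iterate 10 (rw [formK3_single]; decide +kernel)
  all_goals
    rintro _ ⟨i, rfl⟩
    exact model_orth i _ (by decide)

lemma exists_to_model (φ : (Fin 5 → ℤ) →ₗ[ℤ] (Fin 22 → ℤ)) (hinj : Function.Injective φ)
    (hisom : ∀ x y : Fin 5 → ℤ, (φ x) ⬝ᵥ gramK3.mulVec (φ y) = x ⬝ᵥ gramS.mulVec y)
    (hprim : ∀ (x : Fin 22 → ℤ) (c : ℤ), c ≠ 0 → c • x ∈ Set.range φ → x ∈ Set.range φ) :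
    ∃ g : (Fin 22 → ℤ) ≃ₗ[ℤ] (Fin 22 → ℤ), (∀ x y, formK3 (g x) (g y) = formK3 x y) ∧
      ∀ i, g (φ (Pi.single i 1)) = modelS i := by
  obtain ⟨y, hy⟩ := exists_dual φ hinj hprim
  refine tuple_unique formK3 formK3_symm formK3_even (fun i => φ (Pi.single i 1)) y modelS modelZ
    model_planes ?_ ?_ hy ?_
  · intro i j
    rw [formK3_apply, hisom, model_gram]
    simp
  · intro i j hij
    rw [model_gram]
    simp [gramS, hij]
  · intro i j
    rw [model_dual]

/-- The primitive isometric embedding of `S = A₁(-1) ⊕ A₁⁴` into the K3 lattice is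
unique up to an isometry of `L_{K3}`. -/
theorem S_embedding_in_K3_unique
    (φ φ' : (Fin 5 → ℤ) →ₗ[ℤ] (Fin 22 → ℤ))
    (hφinj : Function.Injective φ) (hφ'inj : Function.Injective φ')
    (hφisom : ∀ x y : Fin 5 → ℤ, (φ x) ⬝ᵥ gramK3.mulVec (φ y) = x ⬝ᵥ gramS.mulVec y)
    (hφ'isom : ∀ x y : Fin 5 → ℤ, (φ' x) ⬝ᵥ gramK3.mulVec (φ' y) = x ⬝ᵥ gramS.mulVec y)
    (hφprim : ∀ (x : Fin 22 → ℤ) (c : ℤ), c ≠ 0 → c • x ∈ Set.range φ → x ∈ Set.range φ)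
    (hφ'prim : ∀ (x : Fin 22 → ℤ) (c : ℤ), c ≠ 0 → c • x ∈ Set.range φ' → x ∈ Set.range φ') :
    ∃ γ : Matrix (Fin 22) (Fin 22) ℤ, IsIsometry gramK3 γ ∧
      ∀ x : Fin 5 → ℤ, φ' x = γ.mulVec (φ x) := by
  
  obtain ⟨g, h1, h2⟩ := exists_to_model φ hφinj hφisom hφprim
  obtain ⟨g', h1', h2'⟩ := exists_to_model φ' hφ'inj hφ'isom hφ'prim
  let k : (Fin 22 → ℤ) ≃ₗ[ℤ] (Fin 22 → ℤ) := g.trans g'.symm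
  have hk : ∀ x y, formK3 (k x) (k y) = formK3 x y := by
    intro x y
    rw [← h1', ← h1 x y]
    simp [k]
  refine ⟨LinearMap.toMatrix' k.toLinearMap, ⟨?_, ?_⟩, ?_⟩
  · rw [LinearMap.det_toMatrix']
    exact LinearEquiv.isUnit_det' k
  · ext i j
    have h := hk (Pi.single i 1) (Pi.single j 1)
    rw [formK3_single, formK3_apply] at h
    have e : ∀ x, k x = (LinearMap.toMatrix' k.toLinearMap).mulVec x := by
      intro x
      rw [LinearMap.toMatrix'_mulVec]
      rfl
    rw [← h, e, e, Matrix.mulVec_mulVec, Matrix.dotProduct_mulVec, ← Matrix.mulVec_transpose]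
    rw [Matrix.mulVec_mulVec, Matrix.mulVec_single_one, dotProduct_single_one]
    simp only [Matrix.col_apply]
    rw [← Matrix.transpose_apply (_ * _) i j]
    simp only [Matrix.transpose_mul, Matrix.transpose_transpose, gramK3_symm, Matrix.mul_assoc]
  · intro x
    rw [LinearMap.toMatrix'_mulVec]
    have : φ' = k.toLinearMap ∘ₗ φ := by
      apply LinearMap.pi_ext'
      intro i
      apply LinearMap.ext_ring
      simp only [LinearMap.comp_apply, LinearMap.single_apply, LinearEquiv.coe_coe, k,
        LinearEquiv.trans_apply]
      rw [h2, ← h2', LinearEquiv.symm_apply_apply]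
    rw [this]
    rfl
end

section
/- Let T = ℤ^17 with Gram matrix G of U⊕U⊕E_8⊕A_1^5, with e,f the basis of the first U block and r_1,…,r_5 the A_1 basis vectors. Let I be the set of primitive isotropic vectors: nonzero v ∈ ℤ^17 with vᵀGv = 0 whose coordinates have gcd 1. Then O(T) has exactly two orbits on I, distinguished by whether Gv ∉ 2ℤ^17 (equivalently (v,T) = ℤ) or Gv ∈ 2ℤ^17 (equivalently (v,T) = 2ℤ); representatives are e and 2(e+f) + r_1 + r_2 + r_3 + r_4, i.e. every v ∈ I is O(T)-equivalent to exactly one of these two vectors. -/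
open Matrix

/-- The basis vector `e` of the first copy of `U` in `T`. -/
def eU : Fin 17 → ℤ := Pi.single 0 1

/-- The basis vector `f` of the first copy of `U` in `T`. -/
def fU : Fin 17 → ℤ := Pi.single 1 1

/-- The basis vectors `r₁, …, r₅` of the five copies of `A₁` in `T`. -/
def rA (k : Fin 5) : Fin 17 → ℤ := Pi.single ⟨12 + (k : ℕ), by have := k.isLt; omega⟩ 1

/-- `r` and `r'` lie in the same `O(T)`-orbit. -/
def OrbEquiv (v r : Fin 17 → ℤ) : Prop :=
  ∃ P : Matrix (Fin 17) (Fin 17) ℤ, IsIsometry gramT P ∧ P.mulVec v = r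

/-- A vector of `ℤⁿ` is primitive if the gcd of its coordinates is `1`. -/
def IsPrimitiveVec {n : ℕ} (v : Fin n → ℤ) : Prop :=
  ∀ d : ℤ, (∀ i, d ∣ v i) → IsUnit d

theorem gramT_rows (v : Fin 17 → ℤ) : gramT.mulVec v =
    ![v 1, v 0, v 3, v 2, -2 * v 4 + v 5, v 4 - 2 * v 5 + v 6, v 5 - 2 * v 6 + v 7 + v 11,
      v 6 - 2 * v 7 + v 8, v 7 - 2 * v 8 + v 9, v 8 - 2 * v 9 + v 10, v 9 - 2 * v 10,
      v 6 - 2 * v 11, -2 * v 12, -2 * v 13, -2 * v 14, -2 * v 15, -2 * v 16] := by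
  have h : gramT = !![0,1,0,0,0,0,0,0,0,0,0,0,0,0,0,0,0;
    1,0,0,0,0,0,0,0,0,0,0,0,0,0,0,0,0;
    0,0,0,1,0,0,0,0,0,0,0,0,0,0,0,0,0;
    0,0,1,0,0,0,0,0,0,0,0,0,0,0,0,0,0;
    0,0,0,0,-2,1,0,0,0,0,0,0,0,0,0,0,0;
    0,0,0,0,1,-2,1,0,0,0,0,0,0,0,0,0,0;
    0,0,0,0,0,1,-2,1,0,0,0,1,0,0,0,0,0;
    0,0,0,0,0,0,1,-2,1,0,0,0,0,0,0,0,0;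
    0,0,0,0,0,0,0,1,-2,1,0,0,0,0,0,0,0;
    0,0,0,0,0,0,0,0,1,-2,1,0,0,0,0,0,0;
    0,0,0,0,0,0,0,0,0,1,-2,0,0,0,0,0,0;
    0,0,0,0,0,0,1,0,0,0,0,-2,0,0,0,0,0;
    0,0,0,0,0,0,0,0,0,0,0,0,-2,0,0,0,0;
    0,0,0,0,0,0,0,0,0,0,0,0,0,-2,0,0,0;
    0,0,0,0,0,0,0,0,0,0,0,0,0,0,-2,0,0;
    0,0,0,0,0,0,0,0,0,0,0,0,0,0,0,-2,0;
    0,0,0,0,0,0,0,0,0,0,0,0,0,0,0,0,-2] := by decide +kernel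
  rw [h]
  ext i
  fin_cases i <;> simp [Matrix.mulVec, dotProduct, Fin.sum_univ_succ] <;> ring_nf

theorem gramT_symm : gramTᵀ = gramT := by decide +kernel

theorem gramT_ker (v : Fin 17 → ℤ) (h : gramT.mulVec v = 0) : v = 0 := by
  rw [gramT_rows] at h
  have h' := fun i => congrFun h i
  simp [Fin.forall_fin_succ] at h'
  ext i
  fin_cases i <;> simp <;> omega

theorem gramT_det : gramT.det ≠ 0 := by
  intro h
  obtain ⟨v, hv, hv'⟩ := Matrix.exists_mulVec_eq_zero_iff.mpr h
  exact hv (gramT_ker v hv')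

theorem isom_of (P : Matrix (Fin 17) (Fin 17) ℤ) (h : Pᵀ * gramT * P = gramT) :
    IsIsometry gramT P := by
  refine ⟨?_, h⟩
  have h1 := congrArg Matrix.det h
  rw [Matrix.det_mul, Matrix.det_mul, Matrix.det_transpose] at h1
  have h2 : P.det * P.det = 1 := by
    apply mul_left_cancel₀ gramT_det
    linarith
  exact IsUnit.of_mul_eq_one _ h2

theorem OrbEquiv.symm {v w : Fin 17 → ℤ} (h : OrbEquiv v w) : OrbEquiv w v := by
  obtain ⟨P, ⟨hd, hP⟩, rfl⟩ := h
  refine ⟨P⁻¹, isom_of _ ?_, ?_⟩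
  · conv_lhs => rw [← hP]
    rw [Matrix.mul_assoc, Matrix.mul_assoc, Matrix.mul_nonsing_inv _ hd, Matrix.mul_one,
      ← Matrix.mul_assoc, ← Matrix.transpose_mul, Matrix.mul_nonsing_inv _ hd]
    simp
  · rw [Matrix.mulVec_mulVec, Matrix.nonsing_inv_mul _ hd, Matrix.one_mulVec]

theorem OrbEquiv.trans {v w x : Fin 17 → ℤ} (h : OrbEquiv v w) (h' : OrbEquiv w x) :
    OrbEquiv v x := by
  obtain ⟨P, ⟨_, hP⟩, rfl⟩ := h
  obtain ⟨Q, ⟨_, hQ⟩, rfl⟩ := h'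
  refine ⟨Q * P, isom_of _ ?_, ?_⟩
  · conv_rhs => rw [← hP, ← hQ]
    simp only [Matrix.transpose_mul, Matrix.mul_assoc]
  · rw [Matrix.mulVec_mulVec]

theorem OrbEquiv.refl (v : Fin 17 → ℤ) : OrbEquiv v v :=
  ⟨1, isom_of _ (by simp), by simp⟩

theorem OrbEquiv.neg (v : Fin 17 → ℤ) : OrbEquiv v (-v) :=
  ⟨-1, isom_of _ (by simp), by simp [Matrix.neg_mulVec]⟩

theorem OrbEquiv.perm (σ : Equiv.Perm (Fin 17)) (h : gramT.submatrix σ σ = gramT)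
    (v : Fin 17 → ℤ) : OrbEquiv v (v ∘ σ) := by
  refine ⟨(1 : Matrix (Fin 17) (Fin 17) ℤ).submatrix σ id, isom_of _ ?_, ?_⟩
  · rw [Matrix.transpose_submatrix, Matrix.transpose_one]
    conv_lhs => rw [← h]
    rw [Matrix.submatrix_mul_equiv, Matrix.submatrix_mul_equiv]
    simp
  · ext i
    simp [Matrix.mulVec, dotProduct, Matrix.one_apply]

theorem OrbEquiv.dvd {v w : Fin 17 → ℤ} (h : OrbEquiv v w) (d : ℤ) (hd : ∀ i, d ∣ v i) (i) :
    d ∣ w i := by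
  obtain ⟨P, _, rfl⟩ := h
  change d ∣ ∑ j, P i j * v j
  exact Finset.dvd_sum fun j _ => (hd j).mul_left _

theorem OrbEquiv.prim {v w : Fin 17 → ℤ} (h : OrbEquiv v w) (hp : IsPrimitiveVec v) :
    IsPrimitiveVec w := fun d hd => hp d (h.symm.dvd d hd)

theorem OrbEquiv.iso {v w : Fin 17 → ℤ} (h : OrbEquiv v w) :
    w ⬝ᵥ gramT.mulVec w = v ⬝ᵥ gramT.mulVec v := by
  obtain ⟨P, ⟨_, hP⟩, rfl⟩ := h
  conv_rhs => rw [← hP]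
  rw [← Matrix.mulVec_mulVec, ← Matrix.mulVec_mulVec, Matrix.dotProduct_mulVec v,
    Matrix.vecMul_transpose]

theorem OrbEquiv.gdvd {v w : Fin 17 → ℤ} (h : OrbEquiv v w) (d : ℤ)
    (hd : ∀ i, d ∣ gramT.mulVec v i) (i) : d ∣ gramT.mulVec w i := by
  obtain ⟨P, ⟨_, hP⟩, hw⟩ := h.symm
  rw [← hP, ← Matrix.mulVec_mulVec, ← Matrix.mulVec_mulVec, hw]
  change d ∣ ∑ j, Pᵀ i j * gramT.mulVec v j
  exact Finset.dvd_sum fun j _ => (hd j).mul_left _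

/-- The bilinear form. -/
def Bf (x y : Fin 17 → ℤ) : ℤ := x ⬝ᵥ gramT.mulVec y

theorem Bf_comm (x y : Fin 17 → ℤ) : Bf x y = Bf y x := by
  unfold Bf
  rw [Matrix.dotProduct_mulVec, ← Matrix.mulVec_transpose, gramT_symm, dotProduct_comm]

/-- Eichler transvections. -/
theorem OrbEquiv.eichler (u a : Fin 17 → ℤ) (q : ℤ) (hu : Bf u u = 0) (ha : Bf a u = 0)
    (hq : Bf a a = 2 * q) (v : Fin 17 → ℤ) :
    OrbEquiv v (v - Bf a v • u + Bf u v • a - (q * Bf u v) • u) := by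
  let P : Matrix (Fin 17) (Fin 17) ℤ := 1 - vecMulVec u (gramT.mulVec a)
    + vecMulVec a (gramT.mulVec u) - vecMulVec (q • u) (gramT.mulVec u)
  have hP : ∀ v, P.mulVec v = v - Bf a v • u + Bf u v • a - (q * Bf u v) • u := by
    intro v
    have h1 : gramT.mulVec a ⬝ᵥ v = Bf a v := by rw [Bf_comm, Bf, dotProduct_comm]
    have h2 : gramT.mulVec u ⬝ᵥ v = Bf u v := by rw [Bf_comm, Bf, dotProduct_comm]
    ext i
    simp [P, Matrix.add_mulVec, Matrix.sub_mulVec, Matrix.vecMulVec_mulVec,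
      h1, h2]
    ring
  refine ⟨P, isom_of _ ?_, hP v⟩
  have key : ∀ x y, Bf (P.mulVec x) (P.mulVec y) = Bf x y := by
    intro x y
    rw [hP, hP]
    have ha' : Bf u a = 0 := by rw [Bf_comm, ha]
    have e1 := Bf_comm x u
    have e2 := Bf_comm x a
    simp only [Bf, Matrix.mulVec_add, Matrix.mulVec_sub, Matrix.mulVec_smul, dotProduct_add,
      dotProduct_sub, dotProduct_smul, add_dotProduct, sub_dotProduct, smul_dotProduct,
      smul_eq_mul] at *
    rw [hu, ha, ha', hq, e1, e2]
    ring
  ext i j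
  have := key (Pi.single i 1) (Pi.single j 1)
  have h3 : ∀ M : Matrix (Fin 17) (Fin 17) ℤ,
      (Pi.single i 1 : Fin 17 → ℤ) ⬝ᵥ M.mulVec (Pi.single j 1) = M i j := by
    intro M; simp
  rw [← h3 (Pᵀ * gramT * P), ← h3 gramT]
  rw [Bf, Bf] at this
  rw [← this, ← Matrix.mulVec_mulVec, ← Matrix.mulVec_mulVec,
    Matrix.dotProduct_mulVec (Pi.single i 1), Matrix.vecMul_transpose]

theorem Bf_single_left (i : Fin 17) (v : Fin 17 → ℤ) :
    Bf (Pi.single i 1) v = gramT.mulVec v i := by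
  simp [Bf]

theorem Bf_even (a : Fin 17 → ℤ) : ∃ q, Bf a a = 2 * q := by
  refine ⟨a 0 * a 1 + a 2 * a 3 - a 4 ^ 2 - a 5 ^ 2 - a 6 ^ 2 - a 7 ^ 2 - a 8 ^ 2 - a 9 ^ 2
    - a 10 ^ 2 - a 11 ^ 2 - a 12 ^ 2 - a 13 ^ 2 - a 14 ^ 2 - a 15 ^ 2 - a 16 ^ 2
    + a 4 * a 5 + a 5 * a 6 + a 6 * a 7 + a 7 * a 8 + a 8 * a 9 + a 9 * a 10 + a 6 * a 11, ?_⟩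
  rw [Bf, gramT_rows]
  simp [dotProduct, Fin.sum_univ_succ]
  ring

/-- Reduction of all coordinates modulo the coordinate of `f`. -/
theorem step_e (w : Fin 17 → ℤ) : ∃ w', OrbEquiv w w' ∧ w' 1 = w 1 ∧
    ∀ i, 2 ≤ i → w' i = w i % w 1 := by
  let a : Fin 17 → ℤ := fun i => if 2 ≤ i then -(w i / w 1) else 0
  obtain ⟨q, hq⟩ := Bf_even a
  have h := OrbEquiv.eichler (Pi.single 0 1) a q
    (by rw [Bf_single_left, gramT_rows]; simp)
    (by rw [Bf_comm, Bf_single_left, gramT_rows]; simp [a]) hq w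
  refine ⟨_, h, ?_, ?_⟩
  · have : ¬ (2 : Fin 17) ≤ 1 := by decide
    simp [a, this]
  · intro i hi
    have h0 : i ≠ 0 := by rintro rfl; exact absurd hi (by decide)
    have hB : Bf (Pi.single 0 1) w = w 1 := by rw [Bf_single_left, gramT_rows]; simp
    simp only [Pi.sub_apply, Pi.add_apply, Pi.smul_apply, hB, smul_eq_mul, Pi.single_eq_of_ne h0,
      a, if_pos hi]
    have := Int.emod_add_mul_ediv (w i) (w 1)
    linarith

/-- Transferring the pairing with a basis vector into the second hyperbolic plane. -/
theorem step_e' (w : Fin 17 → ℤ) (h3 : w 3 = 0) (h2 : w 2 = 0) (i : Fin 17) (hi : i ≠ 3) :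
    ∃ w', OrbEquiv w w' ∧ w' 1 = w 1 ∧ w' 2 = -(gramT.mulVec w i) := by
  obtain ⟨q, hq⟩ := Bf_even (Pi.single i 1)
  have h := OrbEquiv.eichler (Pi.single 2 1) (Pi.single i 1) q
    (by rw [Bf_single_left, gramT_rows]; simp)
    (by rw [Bf_comm, Bf_single_left, gramT_rows]; simp [hi.symm]) hq w
  have hB : Bf (Pi.single 2 1) w = 0 := by rw [Bf_single_left, gramT_rows]; simp [h3]
  rw [hB, Bf_single_left] at h
  exact ⟨_, h, by simp, by simp [h2]⟩

theorem perm01 (w : Fin 17 → ℤ) : ∃ w', OrbEquiv w w' ∧ w' 1 = w 0 :=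
  ⟨_, OrbEquiv.perm (Equiv.swap 0 1) (by decide +kernel) w, rfl⟩

theorem perm12 (w : Fin 17 → ℤ) : ∃ w', OrbEquiv w w' ∧ w' 1 = w 2 :=
  ⟨_, OrbEquiv.perm (Equiv.swap 0 3 * Equiv.swap 1 2) (by decide +kernel) w, rfl⟩

theorem perm13 (w : Fin 17 → ℤ) : ∃ w', OrbEquiv w w' ∧ w' 1 = w 3 :=
  ⟨_, OrbEquiv.perm (Equiv.swap 0 2 * Equiv.swap 1 3) (by decide +kernel) w, rfl⟩

theorem start (v : Fin 17 → ℤ) (hv : v ≠ 0) : ∃ w, OrbEquiv v w ∧ w 1 ≠ 0 := by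
  by_cases h0 : v 0 = 0
  swap
  · obtain ⟨w, h, e⟩ := perm01 v
    exact ⟨w, h, by rwa [e]⟩
  by_cases h2 : v 2 = 0
  swap
  · obtain ⟨w, h, e⟩ := perm12 v
    exact ⟨w, h, by rwa [e]⟩
  by_cases h3 : v 3 = 0
  swap
  · obtain ⟨w, h, e⟩ := perm13 v
    exact ⟨w, h, by rwa [e]⟩
  have : ∃ i, gramT.mulVec v i ≠ 0 := by
    by_contra! hc
    exact hv (gramT_ker v (funext hc))
  obtain ⟨i, hi⟩ := this
  have hi3 : i ≠ 3 := by
    rintro rfl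
    apply hi
    rw [gramT_rows]; simpa using h2
  obtain ⟨w, h, -, e⟩ := step_e' v h3 h2 i hi3
  obtain ⟨w', h', e'⟩ := perm12 w
  refine ⟨w', h.trans h', ?_⟩
  rw [e', e]
  simpa using hi

theorem descent (v : Fin 17 → ℤ) (hv : v ≠ 0) : ∃ w, OrbEquiv v w ∧ 0 < w 1 ∧ w 2 = 0 ∧ w 3 = 0 ∧
    (∀ i, 2 ≤ i → 0 ≤ w i ∧ w i < w 1) ∧ ∀ i, w 1 ∣ gramT.mulVec w i := by
  classical
  have hex : ∃ n : ℕ, ∃ w, OrbEquiv v w ∧ 0 < w 1 ∧ (w 1).natAbs = n := by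
    obtain ⟨w, h, h1⟩ := start v hv
    rcases lt_or_gt_of_ne h1 with h1 | h1
    · exact ⟨_, -w, h.trans (OrbEquiv.neg w), by simpa using h1, rfl⟩
    · exact ⟨_, w, h, h1, rfl⟩
  obtain ⟨w₀, hw₀, hpos₀, hn⟩ := Nat.find_spec hex
  have hmin : ∀ w, OrbEquiv v w → 0 < w 1 → w₀ 1 ≤ w 1 := by
    intro w hw hp
    have := Nat.find_min' hex ⟨w, hw, hp, rfl⟩
    omega
  -- divisibility
  have red : ∀ w, OrbEquiv v w → w 1 = w₀ 1 → ∃ w', OrbEquiv w w' ∧ w' 1 = w 1 ∧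
      (∀ i, 2 ≤ i → w' i = w i % w 1) ∧ w 1 ∣ w 2 ∧ w 1 ∣ w 3 := by
    intro w hw h1
    obtain ⟨w', hw', h1', hr⟩ := step_e w
    refine ⟨w', hw', h1', hr, ?_, ?_⟩
    · obtain ⟨x, hx, ex⟩ := perm12 w'
      rw [hr 2 (by decide)] at ex
      have hb := Int.emod_lt_of_pos (w 2) (h1 ▸ hpos₀)
      have hb' := Int.emod_nonneg (w 2) (h1 ▸ hpos₀).ne'
      by_contra hc
      have : w 2 % w 1 ≠ 0 := fun h => hc (Int.dvd_of_emod_eq_zero h)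
      have := hmin x ((hw.trans hw').trans hx) (by omega)
      omega
    · obtain ⟨x, hx, ex⟩ := perm13 w'
      rw [hr 3 (by decide)] at ex
      have hb := Int.emod_lt_of_pos (w 3) (h1 ▸ hpos₀)
      have hb' := Int.emod_nonneg (w 3) (h1 ▸ hpos₀).ne'
      by_contra hc
      have : w 3 % w 1 ≠ 0 := fun h => hc (Int.dvd_of_emod_eq_zero h)
      have := hmin x ((hw.trans hw').trans hx) (by omega)
      omega
  obtain ⟨w, hw, h1, hr, d2, d3⟩ := red w₀ hw₀ rfl
  have h2 : w 2 = 0 := by rw [hr 2 (by decide)]; exact Int.emod_eq_zero_of_dvd d2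
  have h3 : w 3 = 0 := by rw [hr 3 (by decide)]; exact Int.emod_eq_zero_of_dvd d3
  have hvw := hw₀.trans hw
  refine ⟨w, hvw, h1 ▸ hpos₀, h2, h3, ?_, ?_⟩
  · intro i hi
    rw [hr i hi, h1]
    exact ⟨Int.emod_nonneg _ hpos₀.ne', Int.emod_lt_of_pos _ hpos₀⟩
  · intro i
    by_cases hi : i = 3
    · subst hi
      rw [gramT_rows]; simp [h2]
    · obtain ⟨x, hx, e1, e2⟩ := step_e' w h3 h2 i hi
      obtain ⟨_, _, _, _, d, _⟩ := red x (hvw.trans hx) (e1.trans h1)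
      rw [e1, e2] at d
      exact (dvd_neg.mp d)

theorem dvd_two_mul (w : Fin 17 → ℤ) (c : ℤ) (h : ∀ i, c ∣ gramT.mulVec w i) (i) :
    c ∣ 2 * w i ∧ (i < 12 → c ∣ w i) := by
  choose k hk using h
  have hk' := hk
  rw [gramT_rows] at hk'
  simp [Fin.forall_fin_succ] at hk'
  obtain ⟨g0, g1, g2, g3, g4, g5, g6, g7, g8, g9, g10, g11, g12, g13, g14, g15, g16⟩ := hk'
  have a0 : c ∣ w 0 := ⟨_, g1⟩
  have a1 : c ∣ w 1 := ⟨_, g0⟩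
  have a2 : c ∣ w 2 := ⟨_, g3⟩
  have a3 : c ∣ w 3 := ⟨_, g2⟩
  have a4 : c ∣ w 4 := ⟨(-4) * k 4 + (-7) * k 5 + (-10) * k 6 + (-8) * k 7 + (-6) * k 8 + (-4) * k 9 + (-2) * k 10 + (-5) * k 11,
    by linear_combination (-4) * g4 + (-7) * g5 + (-10) * g6 + (-8) * g7 + (-6) * g8 + (-4) * g9 + (-2) * g10 + (-5) * g11⟩
  have a5 : c ∣ w 5 := ⟨(-7) * k 4 + (-14) * k 5 + (-20) * k 6 + (-16) * k 7 + (-12) * k 8 + (-8) * k 9 + (-4) * k 10 + (-10) * k 11,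
    by linear_combination (-7) * g4 + (-14) * g5 + (-20) * g6 + (-16) * g7 + (-12) * g8 + (-8) * g9 + (-4) * g10 + (-10) * g11⟩
  have a6 : c ∣ w 6 := ⟨(-10) * k 4 + (-20) * k 5 + (-30) * k 6 + (-24) * k 7 + (-18) * k 8 + (-12) * k 9 + (-6) * k 10 + (-15) * k 11,
    by linear_combination (-10) * g4 + (-20) * g5 + (-30) * g6 + (-24) * g7 + (-18) * g8 + (-12) * g9 + (-6) * g10 + (-15) * g11⟩
  have a7 : c ∣ w 7 := ⟨(-8) * k 4 + (-16) * k 5 + (-24) * k 6 + (-20) * k 7 + (-15) * k 8 + (-10) * k 9 + (-5) * k 10 + (-12) * k 11,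
    by linear_combination (-8) * g4 + (-16) * g5 + (-24) * g6 + (-20) * g7 + (-15) * g8 + (-10) * g9 + (-5) * g10 + (-12) * g11⟩
  have a8 : c ∣ w 8 := ⟨(-6) * k 4 + (-12) * k 5 + (-18) * k 6 + (-15) * k 7 + (-12) * k 8 + (-8) * k 9 + (-4) * k 10 + (-9) * k 11,
    by linear_combination (-6) * g4 + (-12) * g5 + (-18) * g6 + (-15) * g7 + (-12) * g8 + (-8) * g9 + (-4) * g10 + (-9) * g11⟩
  have a9 : c ∣ w 9 := ⟨(-4) * k 4 + (-8) * k 5 + (-12) * k 6 + (-10) * k 7 + (-8) * k 8 + (-6) * k 9 + (-3) * k 10 + (-6) * k 11,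
    by linear_combination (-4) * g4 + (-8) * g5 + (-12) * g6 + (-10) * g7 + (-8) * g8 + (-6) * g9 + (-3) * g10 + (-6) * g11⟩
  have a10 : c ∣ w 10 := ⟨(-2) * k 4 + (-4) * k 5 + (-6) * k 6 + (-5) * k 7 + (-4) * k 8 + (-3) * k 9 + (-2) * k 10 + (-3) * k 11,
    by linear_combination (-2) * g4 + (-4) * g5 + (-6) * g6 + (-5) * g7 + (-4) * g8 + (-3) * g9 + (-2) * g10 + (-3) * g11⟩
  have a11 : c ∣ w 11 := ⟨(-5) * k 4 + (-10) * k 5 + (-15) * k 6 + (-12) * k 7 + (-9) * k 8 + (-6) * k 9 + (-3) * k 10 + (-8) * k 11,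
    by linear_combination (-5) * g4 + (-10) * g5 + (-15) * g6 + (-12) * g7 + (-9) * g8 + (-6) * g9 + (-3) * g10 + (-8) * g11⟩
  have a12 : c ∣ 2 * w 12 := ⟨-k 12, by linear_combination -g12⟩
  have a13 : c ∣ 2 * w 13 := ⟨-k 13, by linear_combination -g13⟩
  have a14 : c ∣ 2 * w 14 := ⟨-k 14, by linear_combination -g14⟩
  have a15 : c ∣ 2 * w 15 := ⟨-k 15, by linear_combination -g15⟩
  have a16 : c ∣ 2 * w 16 := ⟨-k 16, by linear_combination -g16⟩
  fin_cases i
  · exact ⟨a0.mul_left 2, fun _ => a0⟩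
  · exact ⟨a1.mul_left 2, fun _ => a1⟩
  · exact ⟨a2.mul_left 2, fun _ => a2⟩
  · exact ⟨a3.mul_left 2, fun _ => a3⟩
  · exact ⟨a4.mul_left 2, fun _ => a4⟩
  · exact ⟨a5.mul_left 2, fun _ => a5⟩
  · exact ⟨a6.mul_left 2, fun _ => a6⟩
  · exact ⟨a7.mul_left 2, fun _ => a7⟩
  · exact ⟨a8.mul_left 2, fun _ => a8⟩
  · exact ⟨a9.mul_left 2, fun _ => a9⟩
  · exact ⟨a10.mul_left 2, fun _ => a10⟩
  · exact ⟨a11.mul_left 2, fun _ => a11⟩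
  · exact ⟨a12, fun h => absurd h (by decide)⟩
  · exact ⟨a13, fun h => absurd h (by decide)⟩
  · exact ⟨a14, fun h => absurd h (by decide)⟩
  · exact ⟨a15, fun h => absurd h (by decide)⟩
  · exact ⟨a16, fun h => absurd h (by decide)⟩

theorem classify (v : Fin 17 → ℤ) (hv0 : v ≠ 0)
    (hvprim : IsPrimitiveVec v) (hviso : v ⬝ᵥ gramT.mulVec v = 0) :
    OrbEquiv eU v ∨ OrbEquiv (2 • (eU + fU) + rA 0 + rA 1 + rA 2 + rA 3) v := by
  obtain ⟨w, hvw, hpos, h2, h3, hb, hd⟩ := descent v hv0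
  have hp := hvw.prim hvprim
  have hi : w ⬝ᵥ gramT.mulVec w = 0 := hvw.iso.trans hviso
  have hdd := dvd_two_mul w _ hd
  have hc : w 1 = 1 ∨ w 1 = 2 := by
    rcases Int.even_or_odd' (w 1) with ⟨c, hc | hc⟩
    · right
      have : IsUnit c := by
        apply hp
        intro i
        have := (hdd i).1
        rw [hc] at this
        exact Int.dvd_of_mul_dvd_mul_left (by norm_num) this
      rcases Int.isUnit_iff.mp this with h | h <;> omega
    · left
      have : IsUnit (w 1) := by
        apply hp
        intro i
        refine IsCoprime.dvd_of_dvd_mul_left ?_ (hdd i).1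
        exact ⟨1, -c, by rw [hc]; ring⟩
      rcases Int.isUnit_iff.mp this with h | h <;> omega
  rw [gramT_rows] at hi
  simp [dotProduct, Fin.sum_univ_succ] at hi
  rcases hc with hc | hc
  · left
    have hz : ∀ i, 2 ≤ i → w i = 0 := by
      intro i hi
      have := hb i hi
      omega
    have h0 : w 0 = 0 := by
      simp [hc, hz 2 (by decide), hz 3 (by decide), hz 4 (by decide), hz 5 (by decide),
        hz 6 (by decide), hz 7 (by decide), hz 8 (by decide), hz 9 (by decide),
        hz 10 (by decide), hz 11 (by decide), hz 12 (by decide), hz 13 (by decide),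
        hz 14 (by decide), hz 15 (by decide), hz 16 (by decide)] at hi
      omega
    have hw : w = Pi.single 1 1 := by
      ext i
      by_cases hi : 2 ≤ i
      · have : i ≠ 1 := by rintro rfl; exact absurd hi (by decide)
        rw [hz i hi]; simp [this]
      · have : i = 0 ∨ i = 1 := by omega
        rcases this with rfl | rfl
        · simp [h0]
        · simp [hc]
    have := OrbEquiv.perm (Equiv.swap 0 1) (by decide +kernel) w
    refine (hvw.trans ?_).symm
    convert this
    rw [hw, eU]
    decide +kernel
  · right
    have hz : ∀ i : Fin 17, 2 ≤ i → i < 12 → w i = 0 := by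
      intro i hi hi'
      have h := hb i hi
      have h' := (hdd i).2 hi'
      rw [hc] at h h'
      omega
    have e4 := hz 4 (by decide) (by decide)
    have e5 := hz 5 (by decide) (by decide)
    have e6 := hz 6 (by decide) (by decide)
    have e7 := hz 7 (by decide) (by decide)
    have e8 := hz 8 (by decide) (by decide)
    have e9 := hz 9 (by decide) (by decide)
    have e10 := hz 10 (by decide) (by decide)
    have e11 := hz 11 (by decide) (by decide)
    have hw : w = ![w 0, 2, 0, 0, 0, 0, 0, 0, 0, 0, 0, 0, w 12, w 13, w 14, w 15, w 16] := by
      ext i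
      fin_cases i <;> simp [hc, h2, h3, e4, e5, e6, e7, e8, e9, e10, e11]
    have h01 : ∀ i : Fin 17, 2 ≤ i → w i = 0 ∨ w i = 1 := by
      intro i hi
      have h := hb i hi
      omega
    have h0 : w 1 ∣ w 0 := (hdd 0).2 (by decide)
    have b12 := h01 12 (by decide)
    have b13 := h01 13 (by decide)
    have b14 := h01 14 (by decide)
    have b15 := h01 15 (by decide)
    have b16 := h01 16 (by decide)
    have hne : ¬ (2 ∣ w 0 ∧ w 12 = 0 ∧ w 13 = 0 ∧ w 14 = 0 ∧ w 15 = 0 ∧ w 16 = 0) := by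
      rintro ⟨f0, f12, f13, f14, f15, f16⟩
      have := hp 2 (by
        intro i
        rw [hw]
        fin_cases i <;> simp [f0, f12, f13, f14, f15, f16])
      exact absurd this (by decide)
    rw [hc] at h0
    simp only [hc, h2, h3, e4, e5, e6, e7, e8, e9, e10, e11] at hi
    refine (hvw.trans ?_).symm
    generalize w 0 = x0 at *
    generalize w 12 = x12 at *
    generalize w 13 = x13 at *
    generalize w 14 = x14 at *
    generalize w 15 = x15 at *
    generalize w 16 = x16 at *
    have fin : ∀ j : Fin 17, ∀ hj : gramT.submatrix (Equiv.swap j 16) (Equiv.swap j 16) = gramT,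
        w ∘ Equiv.swap j 16 = 2 • (eU + fU) + rA 0 + rA 1 + rA 2 + rA 3 →
        OrbEquiv w (2 • (eU + fU) + rA 0 + rA 1 + rA 2 + rA 3) := by
      intro j hj h
      rw [← h]
      exact OrbEquiv.perm _ hj w
    have hcases : x0 = 2 ∧ (
        (x12 = 0 ∧ x13 = 1 ∧ x14 = 1 ∧ x15 = 1 ∧ x16 = 1) ∨
        (x12 = 1 ∧ x13 = 0 ∧ x14 = 1 ∧ x15 = 1 ∧ x16 = 1) ∨
        (x12 = 1 ∧ x13 = 1 ∧ x14 = 0 ∧ x15 = 1 ∧ x16 = 1) ∨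
        (x12 = 1 ∧ x13 = 1 ∧ x14 = 1 ∧ x15 = 0 ∧ x16 = 1) ∨
        (x12 = 1 ∧ x13 = 1 ∧ x14 = 1 ∧ x15 = 1 ∧ x16 = 0)) := by
      rcases b12 with rfl | rfl <;> rcases b13 with rfl | rfl <;> rcases b14 with rfl | rfl <;>
        rcases b15 with rfl | rfl <;> rcases b16 with rfl | rfl <;> omega
    obtain ⟨rfl, h | h | h | h | h⟩ := hcases <;> obtain ⟨rfl, rfl, rfl, rfl, rfl⟩ := h
    · exact fin 12 (by decide +kernel) (by rw [hw]; decide +kernel)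
    · exact fin 13 (by decide +kernel) (by rw [hw]; decide +kernel)
    · exact fin 14 (by decide +kernel) (by rw [hw]; decide +kernel)
    · exact fin 15 (by decide +kernel) (by rw [hw]; decide +kernel)
    · exact fin 16 (by decide +kernel) (by rw [hw]; decide +kernel)

/-- `O(T)` has exactly two orbits on the set of (nonzero) primitive isotropic vectors of
`T = U ⊕ U ⊕ E₈ ⊕ A₁⁵`, with representatives `e` and `2(e+f) + r₁ + r₂ + r₃ + r₄`;
they are distinguished by whether `Gv ∉ 2ℤ¹⁷` (i.e. `(v,T) = ℤ`) or `Gv ∈ 2ℤ¹⁷`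
(i.e. `(v,T) = 2ℤ`). -/
theorem OT_orbits_on_primitive_isotropic (v : Fin 17 → ℤ) (hv0 : v ≠ 0)
    (hvprim : IsPrimitiveVec v) (hviso : v ⬝ᵥ gramT.mulVec v = 0) :
    (∃! k : Fin 2, OrbEquiv (![eU, 2 • (eU + fU) + rA 0 + rA 1 + rA 2 + rA 3] k) v) ∧
    (OrbEquiv eU v ↔ ¬ ∀ i, (2 : ℤ) ∣ gramT.mulVec v i) ∧
    (OrbEquiv (2 • (eU + fU) + rA 0 + rA 1 + rA 2 + rA 3) v ↔
      ∀ i, (2 : ℤ) ∣ gramT.mulVec v i) := by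
  have hcl := classify v hv0 hvprim hviso
  have h1 : OrbEquiv eU v → ¬ ∀ i, (2 : ℤ) ∣ gramT.mulVec v i := by
    intro h hc
    have := h.symm.gdvd 2 hc 1
    rw [gramT_rows] at this
    simp [eU] at this
  have h2 : OrbEquiv (2 • (eU + fU) + rA 0 + rA 1 + rA 2 + rA 3) v →
      ∀ i, (2 : ℤ) ∣ gramT.mulVec v i := by
    intro h
    apply h.gdvd 2
    decide +kernel
  refine ⟨?_, ⟨h1, fun h => hcl.resolve_right fun h' => h (h2 h')⟩,
    ⟨h2, fun h => hcl.resolve_left fun h' => h1 h' h⟩⟩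
  rcases hcl with h | h
  · refine ⟨0, by simpa using h, ?_⟩
    intro k hk
    fin_cases k
    · rfl
    · exact absurd (h2 (by simpa using hk)) (h1 h)
  · refine ⟨1, by simpa using h, ?_⟩
    intro k hk
    fin_cases k
    · exact absurd (h2 h) (h1 (by simpa using hk))
    · rfl
end
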